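/- In R = MvPolynomial (Fin 8) ℤ, the second elementary symmetric function of the multiset W((2,2,2,1,1,1,1), 8) of weights of semistandard Young tableaux of shape (2,2,2,1,1,1,1) with entries in {0,…,7} is congruent to 170·e₂ modulo the ideal generated by e₁; equivalently, c₂(γ₈^{(2,2,2,1,1,1,1)}) = 170·c₂(γ₈), the Table 1 entry for the weight α₃+α₇ of SL₈/μ₂. -/

import Mathlib

open MvPolynomial

open scoped Classical in
/-- The multiset `W(lam, n)` of weights of semistandard Young tableaux of shape
`lam` (a list of row lengths) with entries in `{0, …, n-1}`: a tableau assigns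
to each cell `(i, j)` of the Young diagram of `lam` an entry in `Fin n`, weakly
increasing along rows and strictly increasing down columns; its weight is the
sum `∑_{(i,j) ∈ lam} X_{T(i,j)}`. -/
noncomputable def ssytWeights (lam : List ℕ) (n : ℕ) :
    Multiset (MvPolynomial (Fin n) ℤ) :=
  ((Finset.univ : Finset ((i : Fin lam.length) → Fin (lam.get i) → Fin n)).filter
      (fun T =>
        (∀ (i : Fin lam.length) (j j' : Fin (lam.get i)), (j : ℕ) ≤ (j' : ℕ) → T i j ≤ T i j') ∧
        (∀ (i i' : Fin lam.length), (i : ℕ) < (i' : ℕ) →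
          ∀ (j : Fin (lam.get i')) (hj : (j : ℕ) < lam.get i), T i ⟨j, hj⟩ < T i' j))).val.map
    (fun T => ∑ i, ∑ j, MvPolynomial.X (T i j))

/-- Twice the second elementary symmetric function of a multiset is the square of its sum minus
the sum of its squares. -/
theorem Multiset.two_mul_esymm_two {R : Type*} [CommRing R] (s : Multiset R) :
    2 * s.esymm 2 = s.sum ^ 2 - (s.map (· ^ 2)).sum := by
  induction s using Multiset.induction_on with
  | empty => simp [Multiset.esymm, Multiset.powersetCard_zero_right]
  | cons a s ih =>
    have h : (a ::ₘ s).esymm 2 = s.esymm 2 + a * s.sum := by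
      simp [Multiset.esymm, Multiset.powersetCard_cons, Multiset.powersetCard_one,
        Multiset.map_map]
      simpa using Multiset.sum_map_mul_left (s := s) (a := a) (f := id)
    rw [h, mul_add, ih]
    simp only [Multiset.sum_cons, Multiset.map_cons]
    ring

/-- A strictly increasing map `Fin n → Fin (n + 1)` skips exactly one value. -/
theorem Fin.exists_eq_succAbove_of_strictMono {n : ℕ} {f : Fin n → Fin (n + 1)}
    (hf : StrictMono f) : ∃ k : Fin (n + 1), f = k.succAbove := by
  obtain ⟨k, hk⟩ : ∃ k, k ∉ Set.range f := by
    by_contra! h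
    simpa using Fintype.card_le_of_surjective f h
  refine ⟨k, (StrictMono.range_inj hf (Fin.strictMono_succAbove k)).1 ?_⟩
  rw [Fin.range_succAbove]
  refine Set.eq_of_subset_of_ncard_le (fun x hx hxk => hk (hxk ▸ hx)) ?_
  rw [← Set.image_univ, Set.ncard_image_of_injective _ hf.injective, Set.ncard_compl]
  simp

/-- A filling of the shape `(2, 2, 2, 1, 1, 1, 1)` with increasing first column, encoded by
the entry of `{0, …, 7}` missing from the first column and the three entries of the second. -/
abbrev ColumnCode := Fin 8 × Fin 8 × Fin 8 × Fin 8

/-- The codes of semistandard tableaux. -/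
def semistandardCodes : Finset ColumnCode :=
  Finset.univ.filter fun q =>
    q.2.1 < q.2.2.1 ∧ q.2.2.1 < q.2.2.2 ∧
      q.1.succAbove (0 : Fin 7) ≤ q.2.1 ∧ q.1.succAbove (1 : Fin 7) ≤ q.2.2.1 ∧
        q.1.succAbove (2 : Fin 7) ≤ q.2.2.2

/-- The filling with a given code. -/
def ColumnCode.filling (q : ColumnCode) (i : Fin [2, 2, 2, 1, 1, 1, 1].length)
    (j : Fin ([2, 2, 2, 1, 1, 1, 1].get i)) : Fin 8 :=
  if (j : ℕ) = 0 then q.1.succAbove (i : Fin 7)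
  else if (i : ℕ) = 0 then q.2.1 else if (i : ℕ) = 1 then q.2.2.1 else q.2.2.2

/-- The number of occurrences of an entry in the filling with a given code. -/
def ColumnCode.content (q : ColumnCode) (i : Fin 8) : ℕ :=
  (if i = q.1 then 0 else 1) + (if i = q.2.1 then 1 else 0) +
    (if i = q.2.2.1 then 1 else 0) + (if i = q.2.2.2 then 1 else 0)

theorem ColumnCode.filling_injective : Function.Injective ColumnCode.filling := by
  rintro ⟨k, a, b, c⟩ ⟨k', a', b', c'⟩ h
  have e (i j) := congrFun (congrFun h i) j
  have hk : k = k' := by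
    apply Fin.succAbove_left_injective
    funext i
    have hpos : 0 < [2, 2, 2, 1, 1, 1, 1].get i := by revert i; decide
    simpa [filling] using e i ⟨0, hpos⟩
  have ha : a = a' := e 0 (1 : Fin 2)
  have hb : b = b' := e 1 (1 : Fin 2)
  have hc : c = c' := e 2 (1 : Fin 2)
  rw [hk, ha, hb, hc]

theorem ColumnCode.weight_filling (q : ColumnCode) :
    (∑ i, ∑ j, X (q.filling i j) : MvPolynomial (Fin 8) ℤ) =
      ∑ i, (q.content i : MvPolynomial (Fin 8) ℤ) * X i := by
  obtain ⟨k, a, b, c⟩ := q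
  have hcol : (∑ i : Fin 8, (if i = k then 0 else 1) * X i : MvPolynomial (Fin 8) ℤ) =
      ∑ i : Fin 7, X (k.succAbove i) := by
    rw [Fin.sum_univ_succAbove _ k]
    simp [Fin.succAbove_ne]
  have hfill : (∑ i, ∑ j, X (filling (k, a, b, c) i j) : MvPolynomial (Fin 8) ℤ) =
      ∑ i : Fin 7, X (k.succAbove i) + X a + X b + X c := by
    change (∑ i : Fin 7, ∑ j, X (filling (k, a, b, c) i j) : MvPolynomial (Fin 8) ℤ) = _
    rw [Fin.sum_univ_seven, Fin.sum_univ_seven]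
    change (∑ j : Fin 2, X (filling (k, a, b, c) (0 : Fin 7) j)) +
      (∑ j : Fin 2, X (filling (k, a, b, c) (1 : Fin 7) j)) +
      (∑ j : Fin 2, X (filling (k, a, b, c) (2 : Fin 7) j)) +
      (∑ j : Fin 1, X (filling (k, a, b, c) (3 : Fin 7) j)) +
      (∑ j : Fin 1, X (filling (k, a, b, c) (4 : Fin 7) j)) +
      (∑ j : Fin 1, X (filling (k, a, b, c) (5 : Fin 7) j)) +
      (∑ j : Fin 1, X (filling (k, a, b, c) (6 : Fin 7) j)) = _
    simp only [Fin.sum_univ_two, Fin.sum_univ_one]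
    change (X (k.succAbove (0 : Fin 7)) + X a) + (X (k.succAbove (1 : Fin 7)) + X b) +
      (X (k.succAbove (2 : Fin 7)) + X c) + X (k.succAbove (3 : Fin 7)) +
      X (k.succAbove (4 : Fin 7)) + X (k.succAbove (5 : Fin 7)) +
      X (k.succAbove (6 : Fin 7)) = _
    ring
  rw [hfill, ← hcol]
  simp [content, add_mul, Finset.sum_add_distrib]

theorem ColumnCode.filling_row_le (q : ColumnCode) (hq : q ∈ semistandardCodes)
    (i : Fin [2, 2, 2, 1, 1, 1, 1].length) (j j' : Fin ([2, 2, 2, 1, 1, 1, 1].get i))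
    (hj : (j : ℕ) ≤ (j' : ℕ)) : q.filling i j ≤ q.filling i j' := by
  obtain ⟨k, a, b, c⟩ := q
  simp only [semistandardCodes, Finset.mem_filter, Finset.mem_univ, true_and] at hq
  obtain ⟨-, -, ha, hb, hc⟩ := hq
  fin_cases i <;> fin_cases j <;> fin_cases j' <;>
    first
    | exact le_rfl
    | exact ha
    | exact hb
    | exact hc
    | exact absurd hj (by decide)

theorem ColumnCode.filling_column_lt (q : ColumnCode) (hq : q ∈ semistandardCodes)
    (i i' : Fin [2, 2, 2, 1, 1, 1, 1].length) (hi : (i : ℕ) < (i' : ℕ))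
    (j : Fin ([2, 2, 2, 1, 1, 1, 1].get i'))
    (hj : (j : ℕ) < [2, 2, 2, 1, 1, 1, 1].get i) :
    q.filling i ⟨j, hj⟩ < q.filling i' j := by
  obtain ⟨k, a, b, c⟩ := q
  simp only [semistandardCodes, Finset.mem_filter, Finset.mem_univ, true_and] at hq
  obtain ⟨hab, hbc, -⟩ := hq
  by_cases h : (j : ℕ) = 0
  · simp only [filling, h, if_true]
    exact Fin.strictMono_succAbove k hi
  · have hi' : (i' : ℕ) < 3 := by
      by_contra! h3
      have : ∀ i : Fin [2, 2, 2, 1, 1, 1, 1].length, 3 ≤ (i : ℕ) →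
          [2, 2, 2, 1, 1, 1, 1].get i = 1 := by decide
      have := this i' h3
      have := j.isLt
      omega
    obtain ⟨h0, h1⟩ | ⟨h0, h1⟩ | ⟨h0, h1⟩ :
        ((i : ℕ) = 0 ∧ (i' : ℕ) = 1) ∨ ((i : ℕ) = 0 ∧ (i' : ℕ) = 2) ∨
          ((i : ℕ) = 1 ∧ (i' : ℕ) = 2) := by omega
    all_goals simp only [filling, h, h0, h1]
    · simpa using hab
    · simpa using hab.trans hbc
    · simpa using hbc

theorem exists_filling_eq
    (T : (i : Fin [2, 2, 2, 1, 1, 1, 1].length) → Fin ([2, 2, 2, 1, 1, 1, 1].get i) → Fin 8)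
    (hrow : ∀ (i) (j j' : Fin ([2, 2, 2, 1, 1, 1, 1].get i)), (j : ℕ) ≤ (j' : ℕ) →
      T i j ≤ T i j')
    (hcol : ∀ (i i' : Fin [2, 2, 2, 1, 1, 1, 1].length), (i : ℕ) < (i' : ℕ) →
      ∀ (j : Fin ([2, 2, 2, 1, 1, 1, 1].get i')) (hj : (j : ℕ) < [2, 2, 2, 1, 1, 1, 1].get i),
        T i ⟨j, hj⟩ < T i' j) :
    ∃ q ∈ semistandardCodes, q.filling = T := by
  have hpos : ∀ i : Fin [2, 2, 2, 1, 1, 1, 1].length, 0 < [2, 2, 2, 1, 1, 1, 1].get i := by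
    decide
  obtain ⟨k, hk⟩ := Fin.exists_eq_succAbove_of_strictMono (n := 7)
    (f := fun i : Fin 7 => T i ⟨0, hpos i⟩) fun i i' h => hcol i i' h ⟨0, hpos i'⟩ (hpos i)
  have hk' (i : Fin 7) : k.succAbove i = T i ⟨0, hpos i⟩ := (congrFun hk i).symm
  refine ⟨(k, T 0 (1 : Fin 2), T 1 (1 : Fin 2), T 2 (1 : Fin 2)), ?_, ?_⟩
  · simp only [semistandardCodes, Finset.mem_filter, Finset.mem_univ, true_and, hk']
    exact ⟨hcol 0 1 (by decide) (1 : Fin 2) (by decide),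
      hcol 1 2 (by decide) (1 : Fin 2) (by decide), hrow 0 (0 : Fin 2) (1 : Fin 2) (by decide),
      hrow 1 (0 : Fin 2) (1 : Fin 2) (by decide), hrow 2 (0 : Fin 2) (1 : Fin 2) (by decide)⟩
  · funext i j
    by_cases h : (j : ℕ) = 0
    · obtain rfl : j = ⟨0, hpos i⟩ := Fin.ext h
      exact hk' i
    · fin_cases i <;> fin_cases j <;> first | rfl | exact absurd rfl h

theorem ssytWeights_eq_map_semistandardCodes :
    ssytWeights [2, 2, 2, 1, 1, 1, 1] 8 =
      semistandardCodes.val.map fun q => ∑ i, (q.content i : MvPolynomial (Fin 8) ℤ) * X i := by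
  classical
  unfold ssytWeights
  simp_rw [← ColumnCode.weight_filling]
  refine Eq.trans ?_ (Multiset.map_map (fun T : (i : Fin [2, 2, 2, 1, 1, 1, 1].length) →
    Fin ([2, 2, 2, 1, 1, 1, 1].get i) → Fin 8 => ∑ i, ∑ j, (X (T i j) : MvPolynomial (Fin 8) ℤ))
    ColumnCode.filling semistandardCodes.val)
  rw [← Finset.image_val_of_injOn ColumnCode.filling_injective.injOn]
  refine congrArg (fun s => Multiset.map _ (Finset.val s)) ?_
  ext T
  simp only [Finset.mem_filter, Finset.mem_univ, true_and, Finset.mem_image]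
  constructor
  · rintro ⟨hrow, hcol⟩
    exact exists_filling_eq T hrow hcol
  · rintro ⟨q, hq, rfl⟩
    exact ⟨q.filling_row_le hq, q.filling_column_lt hq⟩

theorem sum_content (i : Fin 8) : ∑ q ∈ semistandardCodes, q.content i = 525 := by
  revert i
  decide +kernel

theorem sum_content_mul_content (i j : Fin 8) :
    ∑ q ∈ semistandardCodes, q.content i * q.content j =
      if i = j then 805 else 635 := by
  revert i j
  decide +kernel

/-- `c₂(γ8^[2, 2, 2, 1, 1, 1, 1]) = 170·c₂(γ8)`: the second elementary symmetric function of
the multiset of weights of semistandard Young tableaux of shape `[2, 2, 2, 1, 1, 1, 1]` with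
entries in `{0, …, 7}` is congruent to `170·e₂` modulo the ideal generated
by `e₁`. -/
theorem c2_ssyt_stmt11 :
    Multiset.esymm (ssytWeights [2, 2, 2, 1, 1, 1, 1] 8) 2 - 170 * esymm (Fin 8) ℤ 2
      ∈ Ideal.span {esymm (Fin 8) ℤ 1} := by
  have hsum : ∑ q ∈ semistandardCodes, ∑ i, (q.content i : MvPolynomial (Fin 8) ℤ) * X i =
      525 * ∑ i, X i := by
    rw [Finset.sum_comm, Finset.mul_sum]
    refine Finset.sum_congr rfl fun i _ => ?_
    rw [← Finset.sum_mul, ← Nat.cast_sum, sum_content, Nat.cast_ofNat]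
  have hsq : ∑ q ∈ semistandardCodes, (∑ i, (q.content i : MvPolynomial (Fin 8) ℤ) * X i) ^ 2 =
      635 * (∑ i, X i) ^ 2 + 170 * ∑ i, X i ^ 2 := by
    have hexp (q : ColumnCode) : (∑ i, (q.content i : MvPolynomial (Fin 8) ℤ) * X i) ^ 2 =
        ∑ i, ∑ j, ((q.content i * q.content j : ℕ) : MvPolynomial (Fin 8) ℤ) * (X i * X j) := by
      rw [sq, Finset.sum_mul_sum]
      refine Finset.sum_congr rfl fun i _ => Finset.sum_congr rfl fun j _ => ?_
      push_cast
      ring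
    have hcoeff (i j : Fin 8) : ((if i = j then 805 else 635 : ℕ) : MvPolynomial (Fin 8) ℤ) =
        635 + if i = j then 170 else 0 := by
      split_ifs <;> norm_num
    simp_rw [hexp]
    rw [Finset.sum_comm]
    simp_rw [Finset.sum_comm (s := semistandardCodes), ← Finset.sum_mul, ← Nat.cast_sum,
      sum_content_mul_content, hcoeff, add_mul, Finset.sum_add_distrib, ite_mul, zero_mul,
      Finset.sum_ite_eq, Finset.mem_univ, if_true, ← Finset.mul_sum, ← sq]
    rw [← Finset.sum_mul, ← sq]
  have hW := Multiset.two_mul_esymm_two (ssytWeights [2, 2, 2, 1, 1, 1, 1] 8)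
  rw [ssytWeights_eq_map_semistandardCodes, Multiset.map_map] at hW
  have hW' := hW.trans (congrArg₂ (fun x y => x ^ 2 - y) hsum hsq)
  rw [← ssytWeights_eq_map_semistandardCodes] at hW'
  have he := Multiset.two_mul_esymm_two
    (Finset.univ.val.map (X : Fin 8 → MvPolynomial (Fin 8) ℤ))
  rw [← esymm_eq_multiset_esymm, Multiset.map_map] at he
  replace he : 2 * esymm (Fin 8) ℤ 2 = (∑ i, X i) ^ 2 - ∑ i, X i ^ 2 := he
  rw [Ideal.mem_span_singleton, esymm_one]
  refine ⟨137410 * ∑ i, X i, ?_⟩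
  have h2 : (2 : MvPolynomial (Fin 8) ℤ) ≠ 0 := two_ne_zero
  apply mul_left_cancel₀ h2
  linear_combination hW' - 170 * he
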